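/- In R = MvPolynomial (Fin 8) ℤ, the second elementary symmetric function of the multiset W((2,2,2,1,1), 8) of weights of semistandard Young tableaux of shape (2,2,2,1,1) with entries in {0,…,7} is congruent to 1344·e₂ modulo the ideal generated by e₁; equivalently, c₂(γ₈^{(2,2,2,1,1)}) = 1344·c₂(γ₈), the Table 1 entry for the weight α₃+α₅ of SL₈/μ₂. -/

import Mathlib

open MvPolynomial

open scoped Classical in
/-- The multiset `W(lam, n)` of weights of semistandard Young tableaux of shape
`lam` (a list of row lengths) with entries in `{0, …, n-1}`: a tableau assigns
to each cell `(i, j)` of the Young diagram of `lam` an entry in `Fin n`, weakly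
increasing along rows and strictly increasing down columns; its weight is the
sum `∑_{(i,j) ∈ lam} X_{T(i,j)}`. -/
noncomputable def ssytWeights (lam : List ℕ) (n : ℕ) :
    Multiset (MvPolynomial (Fin n) ℤ) :=
  ((Finset.univ : Finset ((i : Fin lam.length) → Fin (lam.get i) → Fin n)).filter
      (fun T =>
        (∀ (i : Fin lam.length) (j j' : Fin (lam.get i)), (j : ℕ) ≤ (j' : ℕ) → T i j ≤ T i j') ∧
        (∀ (i i' : Fin lam.length), (i : ℕ) < (i' : ℕ) →
          ∀ (j : Fin (lam.get i')) (hj : (j : ℕ) < lam.get i), T i ⟨j, hj⟩ < T i' j))).val.map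
    (fun T => ∑ i, ∑ j, MvPolynomial.X (T i j))

/-- The second Newton identity for multisets. -/
theorem Multiset.two_mul_esymm_two {R : Type*} [CommRing R] (s : Multiset R) :
    2 * s.esymm 2 = s.sum ^ 2 - (s.map (· ^ 2)).sum := by
  induction s using Multiset.induction_on with
  | empty => simp [Multiset.esymm, Multiset.powersetCard_zero_right]
  | cons a s ih =>
    have h : (a ::ₘ s).esymm 2 = s.esymm 2 + a * s.sum := by
      simp only [Multiset.esymm, Multiset.powersetCard_cons, Multiset.powersetCard_one,
        Multiset.map_add, Multiset.sum_add, Multiset.map_map, Function.comp_def,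
        Multiset.prod_cons, Multiset.prod_singleton, Nat.reduceAdd]
      rw [Multiset.sum_map_mul_left (f := fun x => x), Multiset.map_id']
    rw [h, mul_add, ih]
    simp only [Multiset.sum_cons, Multiset.map_cons]
    ring

/-- Fillings of the cells of the Young diagram `(2, 2, 2, 1, 1)` by elements of `Fin 8`. -/
abbrev Filling : Type :=
  (i : Fin [2, 2, 2, 1, 1].length) → Fin ([2, 2, 2, 1, 1].get i) → Fin 8

/-- Semistandardness of a filling, in the form used by `ssytWeights`. -/
def Filling.IsSemistandard (T : Filling) : Prop :=
  (∀ (i : Fin [2, 2, 2, 1, 1].length) (j j' : Fin ([2, 2, 2, 1, 1].get i)),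
    (j : ℕ) ≤ (j' : ℕ) → T i j ≤ T i j') ∧
  (∀ (i i' : Fin [2, 2, 2, 1, 1].length), (i : ℕ) < (i' : ℕ) →
    ∀ (j : Fin ([2, 2, 2, 1, 1].get i')) (hj : (j : ℕ) < [2, 2, 2, 1, 1].get i),
      T i ⟨j, hj⟩ < T i' j)

/-- A filling is determined by the five entries of its first column and the three entries of its
second column. -/
def fillingEquiv :
    Filling ≃ Fin 8 × Fin 8 × Fin 8 × Fin 8 × Fin 8 × Fin 8 × Fin 8 × Fin 8 where
  toFun T := (T 0 (0 : Fin 2), T 1 (0 : Fin 2), T 2 (0 : Fin 2), T 3 (0 : Fin 1), T 4 (0 : Fin 1),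
    T 0 (1 : Fin 2), T 1 (1 : Fin 2), T 2 (1 : Fin 2))
  invFun p := fun i j =>
    if (j : ℕ) = 0 then ![p.1, p.2.1, p.2.2.1, p.2.2.2.1, p.2.2.2.2.1] i
    else ![p.2.2.2.2.2.1, p.2.2.2.2.2.2.1, p.2.2.2.2.2.2.2, 0, 0] i
  left_inv T := by
    funext i j
    fin_cases i <;> fin_cases j <;> rfl
  right_inv p := rfl

theorem Filling.isSemistandard_iff (T : Filling) :
    T.IsSemistandard ↔
      (T 0 (0 : Fin 2) < T 1 (0 : Fin 2) ∧ T 1 (0 : Fin 2) < T 2 (0 : Fin 2) ∧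
        T 2 (0 : Fin 2) < T 3 (0 : Fin 1) ∧ T 3 (0 : Fin 1) < T 4 (0 : Fin 1)) ∧
      T 0 (0 : Fin 2) ≤ T 0 (1 : Fin 2) ∧
      (T 0 (1 : Fin 2) < T 1 (1 : Fin 2) ∧ T 1 (0 : Fin 2) ≤ T 1 (1 : Fin 2)) ∧
      (T 1 (1 : Fin 2) < T 2 (1 : Fin 2) ∧ T 2 (0 : Fin 2) ≤ T 2 (1 : Fin 2)) := by
  constructor
  · rintro ⟨hr, hc⟩
    exact ⟨⟨hc 0 1 (by decide) (0 : Fin 2) (by decide), hc 1 2 (by decide) (0 : Fin 2) (by decide),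
        hc 2 3 (by decide) (0 : Fin 1) (by decide), hc 3 4 (by decide) (0 : Fin 1) (by decide)⟩,
      hr 0 (0 : Fin 2) (1 : Fin 2) (by decide),
      ⟨hc 0 1 (by decide) (1 : Fin 2) (by decide), hr 1 (0 : Fin 2) (1 : Fin 2) (by decide)⟩,
      ⟨hc 1 2 (by decide) (1 : Fin 2) (by decide), hr 2 (0 : Fin 2) (1 : Fin 2) (by decide)⟩⟩
  · rintro ⟨⟨h1, h2, h3, h4⟩, h5, ⟨h6, h7⟩, h8, h9⟩
    constructor
    · intro i j j' hj
      fin_cases i <;> fin_cases j <;> fin_cases j' <;>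
        first
        | exact le_rfl
        | exact absurd hj (by decide)
        | assumption
    · intro i i' hi j hj
      fin_cases i <;> fin_cases i' <;>
        first
        | exact absurd hi (by decide)
        | (fin_cases j <;>
            first
            | exact absurd hj (by decide)
            | assumption
            | exact h1.trans h2
            | exact h2.trans h3
            | exact h3.trans h4
            | exact h6.trans h8
            | exact (h1.trans h2).trans h3
            | exact (h2.trans h3).trans h4
            | exact ((h1.trans h2).trans h3).trans h4)

/-- The sum of `f` over `{0, …, 7}`, unfolded so that it evaluates quickly. -/
def sumEight (f : ℕ → ℕ) : ℕ :=
  f 0 + f 1 + f 2 + f 3 + f 4 + f 5 + f 6 + f 7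

theorem sumEight_eq (f : ℕ → ℕ) : sumEight f = ∑ a : Fin 8, f a := by
  rw [Fin.sum_univ_eight]
  rfl

/-- The sum of `F` over the entries of all semistandard fillings, listed first column first, as
an iterated sum in which each inequality is tested as early as possible. -/
def columnSum (F : ℕ → ℕ → ℕ → ℕ → ℕ → ℕ → ℕ → ℕ → ℕ) : ℕ :=
  sumEight fun a => sumEight fun b => bif Nat.blt a b then sumEight fun c =>
    bif Nat.blt b c then sumEight fun d => bif Nat.blt c d then sumEight fun e =>
      bif Nat.blt d e then sumEight fun x => bif Nat.ble a x then sumEight fun y =>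
        bif Nat.blt x y && Nat.ble b y then sumEight fun z =>
          bif Nat.blt y z && Nat.ble c z then F a b c d e x y z
          else 0 else 0 else 0 else 0 else 0 else 0 else 0

/-- The Iverson bracket `[a = k]`. -/
def indicatorEq (a k : ℕ) : ℕ :=
  bif Nat.beq a k then 1 else 0

theorem indicatorEq_val (a k : Fin 8) : indicatorEq a k = if a = k then 1 else 0 := by
  simp only [indicatorEq, Bool.cond_eq_ite, Nat.beq_eq, Fin.ext_iff]

/-- The number of cells of `T` with entry `k`. -/
def Filling.content (T : Filling) (k : Fin 8) : ℕ :=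
  ∑ i, ∑ j, indicatorEq (T i j) k

/-- The number of entries of an octuple equal to `k`. -/
def octupleContent (k a b c d e x y z : ℕ) : ℕ :=
  indicatorEq a k + indicatorEq b k + indicatorEq c k + indicatorEq d k + indicatorEq e k +
    indicatorEq x k + indicatorEq y k + indicatorEq z k

theorem Filling.sum_cells {M : Type*} [AddCommMonoid M] (T : Filling) (f : Fin 8 → M) :
    ∑ i, ∑ j, f (T i j) =
      f (T 0 (0 : Fin 2)) + f (T 1 (0 : Fin 2)) + f (T 2 (0 : Fin 2)) + f (T 3 (0 : Fin 1)) +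
        f (T 4 (0 : Fin 1)) + f (T 0 (1 : Fin 2)) + f (T 1 (1 : Fin 2)) +
        f (T 2 (1 : Fin 2)) := by
  have h : ∑ i, ∑ j, f (T i j) =
      (∑ j : Fin 2, f (T 0 j)) + (∑ j : Fin 2, f (T 1 j)) + (∑ j : Fin 2, f (T 2 j)) +
        (∑ j : Fin 1, f (T 3 j)) + (∑ j : Fin 1, f (T 4 j)) :=
    Fin.sum_univ_five (fun i : Fin 5 => ∑ j, f (T i j))
  rw [h, Fin.sum_univ_two, Fin.sum_univ_two, Fin.sum_univ_two, Fin.sum_univ_one,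
    Fin.sum_univ_one]
  abel

open scoped Classical in
/-- The set of semistandard fillings. -/
noncomputable def semistandardFillings : Finset Filling :=
  Finset.univ.filter Filling.IsSemistandard

theorem sum_semistandardFillings
    (F : ℕ → ℕ → ℕ → ℕ → ℕ → ℕ → ℕ → ℕ → ℕ) :
    ∑ T ∈ semistandardFillings, F (T 0 (0 : Fin 2)) (T 1 (0 : Fin 2)) (T 2 (0 : Fin 2))
      (T 3 (0 : Fin 1)) (T 4 (0 : Fin 1)) (T 0 (1 : Fin 2)) (T 1 (1 : Fin 2))
      (T 2 (1 : Fin 2)) = columnSum F := by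
  classical
  let G : Fin 8 × Fin 8 × Fin 8 × Fin 8 × Fin 8 × Fin 8 × Fin 8 × Fin 8 → ℕ :=
    fun (a, b, c, d, e, x, y, z) =>
      if (a < b ∧ b < c ∧ c < d ∧ d < e) ∧ a ≤ x ∧ (x < y ∧ b ≤ y) ∧ (y < z ∧ c ≤ z) then
        F a b c d e x y z else 0
  rw [semistandardFillings, Finset.sum_filter, Fintype.sum_equiv fillingEquiv _ G]
  · simp only [Fintype.sum_prod_type, G, columnSum, sumEight_eq, Bool.cond_eq_ite,
      Bool.and_eq_true, Nat.blt_eq, Nat.ble_eq, Fin.val_fin_lt, Fin.val_fin_le]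
    refine Finset.sum_congr rfl fun a _ => Finset.sum_congr rfl fun b _ => ?_
    by_cases hab : a < b
    swap
    · simp only [hab, false_and, if_false, Finset.sum_const_zero]
    rw [if_pos hab]
    refine Finset.sum_congr rfl fun c _ => ?_
    by_cases hbc : b < c
    swap
    · simp only [hbc, false_and, and_false, if_false, Finset.sum_const_zero]
    rw [if_pos hbc]
    refine Finset.sum_congr rfl fun d _ => ?_
    by_cases hcd : c < d
    swap
    · simp only [hcd, false_and, and_false, if_false, Finset.sum_const_zero]
    rw [if_pos hcd]
    refine Finset.sum_congr rfl fun e _ => ?_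
    by_cases hde : d < e
    swap
    · simp only [hde, false_and, and_false, if_false, Finset.sum_const_zero]
    rw [if_pos hde]
    refine Finset.sum_congr rfl fun x _ => ?_
    by_cases hx : a ≤ x
    swap
    · simp only [hx, false_and, and_false, if_false, Finset.sum_const_zero]
    rw [if_pos hx]
    refine Finset.sum_congr rfl fun y _ => ?_
    by_cases hy : x < y ∧ b ≤ y
    swap
    · simp only [hy, false_and, and_false, if_false, Finset.sum_const_zero]
    rw [if_pos hy]
    refine Finset.sum_congr rfl fun z _ => ?_
    simp only [hab, hbc, hcd, hde, hx, hy, true_and, and_self]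
  · intro T
    exact if_congr T.isSemistandard_iff rfl rfl

theorem columnSum_octupleContent (k : Fin 8) : columnSum (octupleContent k) = 2352 := by
  revert k
  decide +kernel

theorem columnSum_octupleContent_mul (k l : Fin 8) :
    columnSum (fun a b c d e x y z =>
      octupleContent k a b c d e x y z * octupleContent l a b c d e x y z) =
      2184 + if k = l then 1344 else 0 := by
  wlog h : k ≤ l generalizing k l
  · simp only [mul_comm (octupleContent k _ _ _ _ _ _ _ _), eq_comm (a := k)]
    exact this l k (le_of_not_ge h)
  revert k l
  decide +kernel

theorem Filling.content_eq (T : Filling) (k : Fin 8) :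
    T.content k = octupleContent k (T 0 (0 : Fin 2)) (T 1 (0 : Fin 2)) (T 2 (0 : Fin 2))
      (T 3 (0 : Fin 1)) (T 4 (0 : Fin 1)) (T 0 (1 : Fin 2)) (T 1 (1 : Fin 2))
      (T 2 (1 : Fin 2)) :=
  T.sum_cells fun m => indicatorEq m k

theorem sum_content (k : Fin 8) : ∑ T ∈ semistandardFillings, T.content k = 2352 := by
  simp only [Filling.content_eq]
  rw [sum_semistandardFillings (octupleContent k), columnSum_octupleContent]

theorem sum_content_mul_content (k l : Fin 8) :
    ∑ T ∈ semistandardFillings, T.content k * T.content l =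
      2184 + if k = l then 1344 else 0 := by
  simp only [Filling.content_eq]
  rw [← columnSum_octupleContent_mul, ← sum_semistandardFillings]

theorem Filling.weight_eq (T : Filling) :
    ∑ i, ∑ j, (X (T i j) : MvPolynomial (Fin 8) ℤ) =
      ∑ k, (T.content k : MvPolynomial (Fin 8) ℤ) * X k := by
  simp only [Filling.content, Nat.cast_sum, Finset.sum_mul]
  rw [Finset.sum_comm]
  refine Finset.sum_congr rfl fun i _ => ?_
  rw [Finset.sum_comm]
  refine Finset.sum_congr rfl fun j _ => ?_
  simp [indicatorEq_val]

theorem ssytWeights_eq :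
    ssytWeights [2, 2, 2, 1, 1] 8 = semistandardFillings.val.map fun T =>
      ∑ k, (T.content k : MvPolynomial (Fin 8) ℤ) * X k := by
  simp only [← Filling.weight_eq]
  unfold ssytWeights semistandardFillings
  refine Multiset.map_congr ?_ ?_
  swap
  · intro T _
    rfl
  refine congrArg Finset.val ?_
  ext T
  simp only [Finset.mem_filter, Finset.mem_univ, true_and]
  exact Iff.rfl

theorem sum_ssytWeights :
    (ssytWeights [2, 2, 2, 1, 1] 8).sum = 2352 * ∑ k, X k := by
  rw [ssytWeights_eq, ← Finset.sum_eq_multiset_sum, Finset.sum_comm, Finset.mul_sum]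
  refine Finset.sum_congr rfl fun k _ => ?_
  rw [← Finset.sum_mul, ← Nat.cast_sum, sum_content, Nat.cast_ofNat]

theorem sum_sq_ssytWeights :
    ((ssytWeights [2, 2, 2, 1, 1] 8).map (· ^ 2)).sum =
      2184 * (∑ k, X k) ^ 2 + 1344 * ∑ k, X k ^ 2 := by
  have h (T : Filling) : (∑ k, (T.content k : MvPolynomial (Fin 8) ℤ) * X k) ^ 2 =
      ∑ k, ∑ l, ((T.content k * T.content l : ℕ) : MvPolynomial (Fin 8) ℤ) * (X k * X l) := by
    rw [sq, Finset.sum_mul_sum]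
    refine Finset.sum_congr rfl fun k _ => Finset.sum_congr rfl fun l _ => ?_
    push_cast
    ring
  rw [ssytWeights_eq, Multiset.map_map]
  simp only [Function.comp_def, h]
  rw [← Finset.sum_eq_multiset_sum, Finset.sum_comm, sq, Finset.sum_mul_sum, Finset.mul_sum,
    Finset.mul_sum, ← Finset.sum_add_distrib]
  refine Finset.sum_congr rfl fun k _ => ?_
  rw [Finset.sum_comm]
  simp only [← Finset.sum_mul, ← Nat.cast_sum, sum_content_mul_content]
  simp [add_mul, Finset.sum_add_distrib, Finset.mul_sum, sq]

theorem two_mul_esymm_two_fin_eight :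
    2 * esymm (Fin 8) ℤ 2 = (∑ k, X k) ^ 2 - ∑ k, X k ^ 2 := by
  rw [esymm_eq_multiset_esymm, Multiset.two_mul_esymm_two, Multiset.map_map]
  rfl

/-- `c₂(γ8^[2, 2, 2, 1, 1]) = 1344·c₂(γ8)`: the second elementary symmetric function of
the multiset of weights of semistandard Young tableaux of shape `[2, 2, 2, 1, 1]` with
entries in `{0, …, 7}` is congruent to `1344·e₂` modulo the ideal generated
by `e₁`. -/
theorem c2_ssyt_stmt10 :
    Multiset.esymm (ssytWeights [2, 2, 2, 1, 1] 8) 2 - 1344 * esymm (Fin 8) ℤ 2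
      ∈ Ideal.span {esymm (Fin 8) ℤ 1} := by
  have hW := Multiset.two_mul_esymm_two (ssytWeights [2, 2, 2, 1, 1] 8)
  rw [sum_ssytWeights, sum_sq_ssytWeights] at hW
  have he := two_mul_esymm_two_fin_eight
  rw [Ideal.mem_span_singleton, esymm_one]
  refine ⟨2764188 * ∑ k, X k, ?_⟩
  refine mul_left_cancel₀ (two_ne_zero : (2 : MvPolynomial (Fin 8) ℤ) ≠ 0) ?_
  linear_combination hW - 1344 * he
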